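/- (Dominance of Schedulability Test 2 over Schedulability Test 1.) Let I be a finite index set. For each i ∈ I, let K_i be a positive natural number, σ_i : Fin K_i → {0,1} a multiframe execution pattern with packed pattern σ_i^p, C_i ≥ 0 a real execution requirement, and D_i, T_i real numbers with 0 < D_i ≤ T_i. Let B : ℝ → ℝ be any function (the total demand bound function of the non-migrating tasks on the processor). If Test 1 holds, i.e., B(t) + ∑_{i ∈ I} D̂̂(σ_i^p, t) ≤ t for all real t > 0, then Test 2 holds, i.e., B(t) + ∑_{i ∈ I} D̂̂(σ_i, t) ≤ t for all real t > 0. -/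

import Mathlib

/-- `ℓ(σ)`: number of nonzero entries of a multiframe execution pattern. -/
def numNonzero {K : ℕ} (σ : Fin K → ℕ) : ℕ :=
  (Finset.univ.filter fun j => σ j = 1).card

/-- The packed pattern `σᵖ` of a pattern `σ`: ones at indices `j < ℓ(σ)`, zeros after. -/
def packedOf {K : ℕ} (σ : Fin K → ℕ) : Fin K → ℕ :=
  fun j => if (j : ℕ) < numNonzero σ then 1 else 0

/-- The demand bound function with pattern:
`D̂̂(σ,t) = s(t)·ℓ(σ)·C + max_{0 ≤ c ≤ K−1} ∑_{j=c}^{c+max(0,nb(t))−1} σ(j mod K)·C`,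
where `s(t) = ⌊t/(K·T)⌋` and `nb(t) = ⌊((t − s(t)·K·T) − D)/T⌋ + 1`. -/
noncomputable def dbfPattern (K : ℕ) (hK : 0 < K) (σ : Fin K → ℕ)
    (C D T t : ℝ) : ℝ :=
  let s : ℤ := ⌊t / (K * T)⌋
  let nb : ℤ := ⌊((t - s * (K * T)) - D) / T⌋ + 1
  (s : ℝ) * (numNonzero σ) * C +
    (Finset.range K).sup' (Finset.nonempty_range_iff.mpr hK.ne')
      (fun c => ∑ j ∈ Finset.range (max 0 nb).toNat,
        (σ ⟨(c + j) % K, Nat.mod_lt _ hK⟩ : ℝ) * C)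

theorem numNonzero_le {K : ℕ} (σ : Fin K → ℕ) : numNonzero σ ≤ K :=
  (Finset.card_filter_le _ _).trans_eq (Finset.card_fin K)

theorem numNonzero_packedOf {K : ℕ} (σ : Fin K → ℕ) :
    numNonzero (packedOf σ) = numNonzero σ := by
  have h := numNonzero_le σ
  have hfilter : (Finset.univ.filter fun j => packedOf σ j = 1) =
      Finset.univ.filter fun j : Fin K => (j : ℕ) < numNonzero σ := by
    ext j
    simp [packedOf]
  rw [numNonzero, hfilter, Fin.card_filter_val_lt, min_eq_right h]

theorem sum_eq_numNonzero {K : ℕ} {σ : Fin K → ℕ} (hσ : ∀ j, σ j = 0 ∨ σ j = 1) :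
    ∑ j, σ j = numNonzero σ := by
  rw [numNonzero, Finset.card_filter]
  refine Finset.sum_congr rfl fun j _ => ?_
  rcases hσ j with h | h <;> simp [h]

/-- A cyclic window of length at most `K` contains at most `min n ℓ(σ)` ones. -/
theorem sum_window_le_min {K : ℕ} (hK : 0 < K) {σ : Fin K → ℕ}
    (hσ : ∀ j, σ j = 0 ∨ σ j = 1) (c : ℕ) {n : ℕ} (hn : n ≤ K) :
    ∑ j ∈ Finset.range n, σ ⟨(c + j) % K, Nat.mod_lt _ hK⟩ ≤ min n (numNonzero σ) := by
  refine le_min ?_ ?_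
  · calc ∑ j ∈ Finset.range n, σ ⟨(c + j) % K, Nat.mod_lt _ hK⟩
        ≤ ∑ _j ∈ Finset.range n, 1 := Finset.sum_le_sum fun j _ => by
          rcases hσ ⟨(c + j) % K, Nat.mod_lt _ hK⟩ with h | h <;> simp [h]
      _ = n := by simp
  · have hinj : Set.InjOn (fun j => (⟨(c + j) % K, Nat.mod_lt _ hK⟩ : Fin K))
        (Finset.range n) := by
      intro a ha b hb hab
      have ha' : a < K := (Finset.mem_range.mp ha).trans_le hn
      have hb' : b < K := (Finset.mem_range.mp hb).trans_le hn
      have hmod : c + a ≡ c + b [MOD K] := Fin.mk.inj hab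
      exact (Nat.ModEq.add_left_cancel' c hmod).eq_of_lt_of_lt ha' hb'
    rw [← sum_eq_numNonzero hσ, ← Finset.sum_image (f := σ) hinj]
    exact Finset.sum_le_sum_of_subset (Finset.subset_univ _)

/-- The window of the packed pattern starting at frame `0` contains `min n ℓ(σ)` ones. -/
theorem sum_window_packedOf_zero {K : ℕ} (hK : 0 < K) (σ : Fin K → ℕ) {n : ℕ} (hn : n ≤ K) :
    ∑ j ∈ Finset.range n, packedOf σ ⟨(0 + j) % K, Nat.mod_lt _ hK⟩ =
      min n (numNonzero σ) := by
  have hfilter : (Finset.range n).filter (· < numNonzero σ) =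
      Finset.range (min n (numNonzero σ)) := by
    ext j
    simp
  calc ∑ j ∈ Finset.range n, packedOf σ ⟨(0 + j) % K, Nat.mod_lt _ hK⟩
      = ∑ j ∈ Finset.range n, if j < numNonzero σ then 1 else 0 :=
        Finset.sum_congr rfl fun j hj => by
          have hjK : j < K := (Finset.mem_range.mp hj).trans_le hn
          simp [packedOf, Nat.mod_eq_of_lt hjK]
    _ = min n (numNonzero σ) := by
        rw [← Finset.card_filter, hfilter, Finset.card_range]

/-- The number of deadlines in the remainder of a hyperperiod is at most `K`. -/
theorem toNat_residual_jobs_le {K : ℕ} (hK : 0 < K) {D T : ℝ} (hD : 0 < D) (hDT : D ≤ T)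
    (t : ℝ) :
    (max 0 (⌊((t - ⌊t / (K * T)⌋ * (K * T)) - D) / T⌋ + 1)).toNat ≤ K := by
  have hT : 0 < T := hD.trans_le hDT
  have hKT : 0 < (K : ℝ) * T := mul_pos (Nat.cast_pos.mpr hK) hT
  have hres : t < (⌊t / (K * T)⌋ + 1) * (K * T) :=
    (div_lt_iff₀ hKT).mp (Int.lt_floor_add_one _)
  have hfloor : ⌊((t - ⌊t / (K * T)⌋ * (K * T)) - D) / T⌋ < (K : ℤ) := by
    rw [Int.floor_lt, div_lt_iff₀ hT, Int.cast_natCast]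
    linarith
  omega

/-- Packing the ones of a pattern to the front does not decrease its demand bound. -/
theorem dbfPattern_le_dbfPattern_packedOf {K : ℕ} (hK : 0 < K) {σ : Fin K → ℕ}
    (hσ : ∀ j, σ j = 0 ∨ σ j = 1) {C D T : ℝ} (hC : 0 ≤ C) (hD : 0 < D) (hDT : D ≤ T)
    (t : ℝ) :
    dbfPattern K hK σ C D T t ≤ dbfPattern K hK (packedOf σ) C D T t := by
  have hn := toNat_residual_jobs_le hK hD hDT t
  simp only [dbfPattern, numNonzero_packedOf]
  refine add_le_add_right (Finset.sup'_le _ _ fun c _ => ?_) _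
  refine le_trans ?_ (Finset.le_sup' _ (Finset.mem_range.mpr hK))
  simp only [← Finset.sum_mul, ← Nat.cast_sum]
  refine mul_le_mul_of_nonneg_right (Nat.cast_le.mpr ?_) hC
  exact (sum_window_le_min hK hσ c hn).trans_eq (sum_window_packedOf_zero hK σ hn).symm

/-- **Dominance of Schedulability Test 2 over Test 1.**
On a processor with finitely many migrating multiframe tasks (indices `i : I`,
each with `K i` frames, pattern `σ i`, WCET `C i ≥ 0`, deadline/period
`0 < D i ≤ T i`) and non-migrating demand `B : ℝ → ℝ`: if Test 1 holds
(`B t + ∑ᵢ D̂̂((σ i)ᵖ, t) ≤ t` for all `t > 0`), then Test 2 holds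
(`B t + ∑ᵢ D̂̂(σ i, t) ≤ t` for all `t > 0`). -/
theorem test2_dominates_test1
    (I : Type*) [Fintype I]
    (K : I → ℕ) (hK : ∀ i, 0 < K i)
    (σ : ∀ i, Fin (K i) → ℕ) (hσ : ∀ i j, σ i j = 0 ∨ σ i j = 1)
    (C D T : I → ℝ) (hC : ∀ i, 0 ≤ C i) (hD : ∀ i, 0 < D i) (hDT : ∀ i, D i ≤ T i)
    (B : ℝ → ℝ)
    (test1 : ∀ t : ℝ, 0 < t →
      B t + ∑ i : I, dbfPattern (K i) (hK i) (packedOf (σ i)) (C i) (D i) (T i) t ≤ t) :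
    ∀ t : ℝ, 0 < t →
      B t + ∑ i : I, dbfPattern (K i) (hK i) (σ i) (C i) (D i) (T i) t ≤ t := by
  intro t ht
  refine le_trans (add_le_add_right (Finset.sum_le_sum fun i _ => ?_) (B t)) (test1 t ht)
  exact dbfPattern_le_dbfPattern_packedOf (hK i) (hσ i) (hC i) (hD i) (hDT i) t
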